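/- Let d ≥ 2 and let v : [0,∞) → ℝ be an increasing twice continuously differentiable function with v''(r) ≥ 1 for all r ≥ 0, and let μ be the measure on ℝ^d with density e^{v(|x|)} with respect to Lebesgue measure. Then for every r_0 ≥ √(d+2) and every bounded open set A ⊂ ℝ^d with smooth boundary satisfying μ(A) = μ(B_{r_0}), one has μ⁺(∂A) ≥ μ⁺(∂B_{r_0}): among all such sets of the same μ-measure, the ball B_{r_0} has the minimal surface measure. -/

import Mathlib

open MeasureTheory Metric Filter Set
open scoped ENNReal

/-- The (lower outer) surface measure `μ⁺(∂A) = liminf_{ε→0⁺} (μ(A^ε) − μ(A))/ε`,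
where `A^ε` is the open `ε`-neighborhood of `A`. -/
noncomputable def surfaceMeasure {X : Type*} [PseudoEMetricSpace X] [MeasurableSpace X]
    (μ : Measure X) (A : Set X) : ℝ≥0∞ :=
  Filter.liminf (fun ε : ℝ => (μ (Metric.thickening ε A) - μ A) / ENNReal.ofReal ε)
    (nhdsWithin 0 (Set.Ioi 0))

/-- `A` has smooth boundary: near every boundary point, `A` is the sublevel set of a
smooth function with nonvanishing differential. -/
def HasSmoothBoundary {d : ℕ} (A : Set (EuclideanSpace ℝ (Fin d))) : Prop :=
  ∀ x ∈ frontier A, ∃ U : Set (EuclideanSpace ℝ (Fin d)), IsOpen U ∧ x ∈ U ∧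
    ∃ g : EuclideanSpace ℝ (Fin d) → ℝ, ContDiff ℝ (⊤ : ℕ∞) g ∧ (∀ y ∈ U, fderiv ℝ g y ≠ 0) ∧
      A ∩ U = {y | g y < 0} ∩ U

/-- The measure on `ℝ^d` with density `e^{v(|x|)}` with respect to Lebesgue measure. -/
noncomputable def radMeasure (d : ℕ) (v : ℝ → ℝ) : Measure (EuclideanSpace ℝ (Fin d)) :=
  volume.withDensity fun x => ENNReal.ofReal (Real.exp (v ‖x‖))

lemma polar_lintegral {d : ℕ} (hd : 2 ≤ d) (F : EuclideanSpace ℝ (Fin d) → ℝ≥0∞)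
    (hF : Measurable F) :
    ∫⁻ x, F x = ∫⁻ θ : sphere (0 : EuclideanSpace ℝ (Fin d)) 1,
      (∫⁻ r in Ioi (0 : ℝ), ENNReal.ofReal (r ^ (d - 1)) * F (r • (θ : EuclideanSpace ℝ (Fin d))))
        ∂(volume : Measure (EuclideanSpace ℝ (Fin d))).toSphere := by
  have : Nontrivial (EuclideanSpace ℝ (Fin d)) := by
    have : Nonempty (Fin d) := ⟨⟨0, by omega⟩⟩
    infer_instance
  have hmp := (volume : Measure (EuclideanSpace ℝ (Fin d))).measurePreserving_homeomorphUnitSphereProd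
  have hfr : Module.finrank ℝ (EuclideanSpace ℝ (Fin d)) = d := by simp
  rw [hfr] at hmp
  have h1 : ∫⁻ x, F x = ∫⁻ x : ({(0)}ᶜ : Set (EuclideanSpace ℝ (Fin d))), F x
      ∂((volume : Measure (EuclideanSpace ℝ (Fin d))).comap (↑)) := by
    rw [lintegral_subtype_comap (measurableSet_singleton _).compl, restrict_compl_singleton]
  have hm : Measurable fun p : sphere (0 : EuclideanSpace ℝ (Fin d)) 1 × Ioi (0 : ℝ) =>
      F ((p.2 : ℝ) • (p.1 : EuclideanSpace ℝ (Fin d))) := by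
    apply hF.comp
    fun_prop
  have h2 : ∫⁻ x : ({(0)}ᶜ : Set (EuclideanSpace ℝ (Fin d))), F x
      ∂((volume : Measure (EuclideanSpace ℝ (Fin d))).comap (↑)) =
      ∫⁻ p : sphere (0 : EuclideanSpace ℝ (Fin d)) 1 × Ioi (0 : ℝ),
        F ((p.2 : ℝ) • (p.1 : EuclideanSpace ℝ (Fin d)))
        ∂((volume : Measure (EuclideanSpace ℝ (Fin d))).toSphere.prod
          (Measure.volumeIoiPow (d - 1))) := by
    rw [← hmp.lintegral_comp hm]
    refine lintegral_congr fun x => ?_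
    have : ‖(x : EuclideanSpace ℝ (Fin d))‖ ≠ 0 := norm_ne_zero_iff.2 x.2
    simp [smul_smul, this]
  rw [h1, h2, lintegral_prod _ hm.aemeasurable]
  refine lintegral_congr fun θ => ?_
  rw [Measure.volumeIoiPow, lintegral_withDensity_eq_lintegral_mul _ (by fun_prop)
    (g := fun y : Ioi (0 : ℝ) => F ((y : ℝ) • (θ : EuclideanSpace ℝ (Fin d))))
    (hm.comp measurable_prodMk_left)]
  exact lintegral_subtype_comap measurableSet_Ioi
    (fun r : ℝ => ENNReal.ofReal (r ^ (d - 1)) * F (r • (θ : EuclideanSpace ℝ (Fin d))))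

lemma polar_set {d : ℕ} (hd : 2 ≤ d) (f : ℝ → ℝ≥0∞) (hf : Measurable f)
    (S : Set (EuclideanSpace ℝ (Fin d))) (hS : MeasurableSet S) :
    ∫⁻ x in S, f ‖x‖ = ∫⁻ θ : sphere (0 : EuclideanSpace ℝ (Fin d)) 1,
      (∫⁻ r in Ioi (0 : ℝ) ∩ {r | r • (θ : EuclideanSpace ℝ (Fin d)) ∈ S},
        ENNReal.ofReal (r ^ (d - 1)) * f r)
        ∂(volume : Measure (EuclideanSpace ℝ (Fin d))).toSphere := by
  rw [← lintegral_indicator hS, polar_lintegral hd (S.indicator fun x => f ‖x‖)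
    ((hf.comp measurable_norm).indicator hS)]
  refine lintegral_congr fun θ => ?_
  have hmS : MeasurableSet {r : ℝ | r • (θ : EuclideanSpace ℝ (Fin d)) ∈ S} := by
    apply hS.preimage (f := fun r : ℝ => r • (θ : EuclideanSpace ℝ (Fin d)))
    fun_prop
  rw [inter_comm, ← Measure.restrict_restrict hmS, ← lintegral_indicator hmS]
  refine setLIntegral_congr_fun measurableSet_Ioi fun r hr => ?_
  have hr : 0 < r := hr
  have hn : ‖r • (θ : EuclideanSpace ℝ (Fin d))‖ = r := by
    simp [norm_smul, abs_of_pos hr]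
  by_cases h : r • (θ : EuclideanSpace ℝ (Fin d)) ∈ S
  · simp [indicator, h, hn]
  · simp [indicator, h]

/-- One-dimensional change of variables along a ray. -/
lemma ray_eq (n : ℕ) (T T' V : ℝ → ℝ) (hT : ∀ r, HasDerivAt T (T' r) r)
    (hT' : ∀ r, 0 ≤ T' r) (hpos : ∀ r, 0 < r → 0 < T r) (s : Set ℝ)
    (hs : MeasurableSet s) (hs0 : s ⊆ Ioi 0) :
    ∫⁻ r in s, ENNReal.ofReal (r ^ n) *
      ENNReal.ofReal (T' r * (T r / r) ^ n * Real.exp (V (T r))) =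
    ∫⁻ r in T '' s, ENNReal.ofReal (r ^ n) * ENNReal.ofReal (Real.exp (V r)) := by
  have hmono : Monotone T := monotone_of_hasDerivAt_nonneg hT hT'
  rw [lintegral_image_eq_lintegral_deriv_mul_of_monotoneOn hs
    (fun x _ => (hT x).hasDerivWithinAt) (hmono.monotoneOn _)]
  refine setLIntegral_congr_fun hs fun r hr => ?_
  have hr : 0 < r := hs0 hr
  have hTr := hpos r hr
  rw [← ENNReal.ofReal_mul (by positivity), ← ENNReal.ofReal_mul (by positivity),
    ← ENNReal.ofReal_mul (hT' r)]
  congr 1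
  rw [div_pow]
  field_simp

lemma transport_le {d : ℕ} (hd : 2 ≤ d) (T T' V : ℝ → ℝ) (hT : ∀ r, HasDerivAt T (T' r) r)
    (hT' : ∀ r, 0 ≤ T' r) (hpos : ∀ r, 0 < r → 0 < T r) (hV : Continuous V)
    (hTc : Continuous T')
    (S S' : Set (EuclideanSpace ℝ (Fin d))) (hS : MeasurableSet S) (hS' : MeasurableSet S')
    (h : ∀ (θ : EuclideanSpace ℝ (Fin d)) (r : ℝ), ‖θ‖ = 1 → 0 < r → r • θ ∈ S → T r • θ ∈ S') :
    ∫⁻ x in S, ENNReal.ofReal (T' ‖x‖ * (T ‖x‖ / ‖x‖) ^ (d - 1) * Real.exp (V (T ‖x‖))) ≤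
      ∫⁻ x in S', ENNReal.ofReal (Real.exp (V ‖x‖)) := by
  have hTcont : Continuous T := continuous_iff_continuousAt.2 fun r => (hT r).continuousAt
  rw [polar_set hd (fun r => ENNReal.ofReal (T' r * (T r / r) ^ (d - 1) * Real.exp (V (T r))))
    (by fun_prop) S hS,
    polar_set hd (fun r => ENNReal.ofReal (Real.exp (V r))) (by fun_prop) S' hS']
  refine lintegral_mono fun θ => ?_
  have hmS : MeasurableSet {r : ℝ | r • (θ : EuclideanSpace ℝ (Fin d)) ∈ S} := by
    apply hS.preimage (f := fun r : ℝ => r • (θ : EuclideanSpace ℝ (Fin d)))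
    fun_prop
  simp only
  rw [ray_eq (d - 1) T T' V hT hT' hpos _ (measurableSet_Ioi.inter hmS) inter_subset_left]
  refine lintegral_mono_set ?_
  rintro _ ⟨r, ⟨hr, hrS⟩, rfl⟩
  exact ⟨hpos r hr, h θ r (by simp) hr hrS⟩

lemma transport_ge {d : ℕ} (hd : 2 ≤ d) (T T' V : ℝ → ℝ) (hT : ∀ r, HasDerivAt T (T' r) r)
    (hT' : ∀ r, 0 ≤ T' r) (hpos : ∀ r, 0 < r → 0 < T r) (hV : Continuous V)
    (hTc : Continuous T')
    (S S' : Set (EuclideanSpace ℝ (Fin d))) (hS : MeasurableSet S) (hS' : MeasurableSet S')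
    (h : ∀ (θ : EuclideanSpace ℝ (Fin d)) (t : ℝ), ‖θ‖ = 1 → 0 < t → t • θ ∈ S' →
      ∃ r, 0 < r ∧ r • θ ∈ S ∧ T r = t) :
    ∫⁻ x in S', ENNReal.ofReal (Real.exp (V ‖x‖)) ≤
    ∫⁻ x in S, ENNReal.ofReal (T' ‖x‖ * (T ‖x‖ / ‖x‖) ^ (d - 1) * Real.exp (V (T ‖x‖))) := by
  have hTcont : Continuous T := continuous_iff_continuousAt.2 fun r => (hT r).continuousAt
  rw [polar_set hd (fun r => ENNReal.ofReal (T' r * (T r / r) ^ (d - 1) * Real.exp (V (T r))))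
    (by fun_prop) S hS,
    polar_set hd (fun r => ENNReal.ofReal (Real.exp (V r))) (by fun_prop) S' hS']
  refine lintegral_mono fun θ => ?_
  have hmS : MeasurableSet {r : ℝ | r • (θ : EuclideanSpace ℝ (Fin d)) ∈ S} := by
    apply hS.preimage (f := fun r : ℝ => r • (θ : EuclideanSpace ℝ (Fin d)))
    fun_prop
  simp only
  rw [ray_eq (d - 1) T T' V hT hT' hpos _ (measurableSet_Ioi.inter hmS) inter_subset_left]
  refine lintegral_mono_set ?_
  rintro t ⟨ht, htS⟩
  obtain ⟨r, hr, hrS, rfl⟩ := h θ t (by simp) ht htS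
  exact ⟨r, ⟨hr, hrS⟩, rfl⟩

/-- Rearrangement: a function below `c k` on `B` and above `c k` off `B`. -/
lemma swap_le {X : Type*} [MeasurableSpace X] (ν : Measure X) (g k : X → ℝ≥0∞) (c : ℝ≥0∞)
    (hk : Measurable k) (A B : Set X) (hA : MeasurableSet A)
    (hB : MeasurableSet B) (hfin : ∫⁻ x in B, k x ∂ν ≠ ∞)
    (heq : ∫⁻ x in A, k x ∂ν = ∫⁻ x in B, k x ∂ν)
    (h1 : ∀ x ∈ B, x ∉ A → g x ≤ c * k x) (h2 : ∀ x ∉ B, c * k x ≤ g x) :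
    ∫⁻ x in B, g x ∂ν ≤ ∫⁻ x in A, g x ∂ν := by
  have hd : ∫⁻ x in B \ A, k x ∂ν = ∫⁻ x in A \ B, k x ∂ν := by
    have e1 := lintegral_inter_add_sdiff (μ := ν) k B hA
    have e2 := lintegral_inter_add_sdiff (μ := ν) k A hB
    rw [inter_comm] at e2
    rw [← e1, ← e2] at heq
    rw [← e1] at hfin
    exact ((ENNReal.add_right_inj (ENNReal.add_ne_top.1 hfin).1).1 heq).symm
  rw [← lintegral_inter_add_sdiff (μ := ν) g B hA, ← lintegral_inter_add_sdiff (μ := ν) g A hB,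
    inter_comm A B]
  gcongr 1
  calc ∫⁻ x in B \ A, g x ∂ν ≤ ∫⁻ x in B \ A, c * k x ∂ν :=
        setLIntegral_mono' (hB.diff hA) fun x hx => h1 x hx.1 hx.2
    _ = c * ∫⁻ x in B \ A, k x ∂ν := lintegral_const_mul _ hk
    _ = c * ∫⁻ x in A \ B, k x ∂ν := by rw [hd]
    _ = ∫⁻ x in A \ B, c * k x ∂ν := (lintegral_const_mul _ hk).symm
    _ ≤ ∫⁻ x in A \ B, g x ∂ν :=
        setLIntegral_mono' (hA.diff hB) fun x hx => h2 x hx.2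

/-- The map `T` and its derivative. -/
lemma hasDerivAt_T (r0 ε : ℝ) (r : ℝ) :
    HasDerivAt (fun r : ℝ => r + ε * (1 - (max (1 - r / r0) 0) ^ 2))
      (1 + ε * (2 / r0 * max (1 - r / r0) 0)) r := by
  have key : ∀ u : ℝ, HasDerivAt (fun u : ℝ => (max u 0) ^ 2) (2 * max u 0) u := by
    intro u
    rcases lt_trichotomy u 0 with h | h | h
    · have : HasDerivAt (fun _ : ℝ => (0 : ℝ)) 0 u := hasDerivAt_const _ _
      rw [max_eq_right h.le]
      simp only [mul_zero]
      refine this.congr_of_eventuallyEq ?_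
      filter_upwards [Iio_mem_nhds h] with y hy
      rw [mem_Iio] at hy
      simp [max_eq_right (le_of_lt hy)]
    · subst h
      simp only [max_self, mul_zero]
      rw [hasDerivAt_iff_isLittleO_nhds_zero]
      simp only [zero_add, max_self, smul_zero, sub_zero]
      refine Asymptotics.IsBigO.trans_isLittleO (g := fun h : ℝ => h ^ 2) ?_ ?_
      · refine Asymptotics.IsBigO.of_bound 1 (Eventually.of_forall fun h => ?_)
        rcases le_total h 0 with hh | hh
        · simp [max_eq_right hh, sq_nonneg]
        · simp [max_eq_left hh]
      · simpa using Asymptotics.isLittleO_pow_id (𝕜 := ℝ) (n := 2) (by norm_num)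
    · rw [max_eq_left h.le]
      have : HasDerivAt (fun y : ℝ => y ^ 2) (2 * u) u := by simpa using hasDerivAt_pow 2 u
      refine this.congr_of_eventuallyEq ?_
      filter_upwards [Ioi_mem_nhds h] with y hy
      rw [mem_Ioi] at hy
      simp [max_eq_left (le_of_lt hy)]
  have h1 : HasDerivAt (fun r : ℝ => 1 - r / r0) (-(1 / r0)) r := by
    simpa using ((hasDerivAt_id r).div_const r0).const_sub 1
  have h2 := (key (1 - r / r0)).comp r h1
  have h3 := (hasDerivAt_id r).add ((h2.const_sub 1).const_mul ε)
  refine h3.congr_deriv ?_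
  ring

lemma ineq_in (n : ℕ) (η m a b q : ℝ) (hη : 0 ≤ η) (hm : 0 ≤ m)
    (h : ((n : ℝ) + 2) * (η * m) + a ≤ b) :
    (1 + 2 * (η * m)) * (1 + η * (1 + m)) ^ n * Real.exp (a + q) ≤
      (1 + η) ^ n * Real.exp (b) * Real.exp q := by
  have h1 : 1 + 2 * (η * m) ≤ Real.exp (2 * (η * m)) := by
    linarith [Real.add_one_le_exp (2 * (η * m))]
  have h2 : 1 + η * (1 + m) ≤ (1 + η) * Real.exp (η * m) := by
    have := Real.add_one_le_exp (η * m)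
    have : (1 + η) * (η * m + 1) ≤ (1 + η) * Real.exp (η * m) := by gcongr
    nlinarith [mul_nonneg hη (mul_nonneg hη hm)]
  calc (1 + 2 * (η * m)) * (1 + η * (1 + m)) ^ n * Real.exp (a + q)
      ≤ Real.exp (2 * (η * m)) * ((1 + η) * Real.exp (η * m)) ^ n * Real.exp (a + q) := by
        gcongr
    _ = (1 + η) ^ n * Real.exp (((n : ℝ) + 2) * (η * m) + a) * Real.exp q := by
        rw [mul_pow, ← Real.exp_nat_mul, Real.exp_add, Real.exp_add, add_mul, Real.exp_add]
        ring
    _ ≤ _ := by gcongr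

lemma ineq_out (n : ℕ) (x y δ a b q : ℝ) (hy : 0 ≤ y) (hδ : 0 ≤ δ) (hxy : x = y + δ)
    (h : (n : ℝ) * δ + a ≤ b) :
    (1 + x) ^ n * Real.exp a * Real.exp q ≤ (1 + y) ^ n * Real.exp (b + q) := by
  have h2 : 1 + x ≤ (1 + y) * Real.exp δ := by
    have := Real.add_one_le_exp δ
    have : (1 + y) * (δ + 1) ≤ (1 + y) * Real.exp δ := by gcongr
    nlinarith [mul_nonneg hy hδ]
  calc (1 + x) ^ n * Real.exp a * Real.exp q
      ≤ ((1 + y) * Real.exp δ) ^ n * Real.exp a * Real.exp q := by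
        have : 0 ≤ 1 + x := by linarith
        gcongr
    _ = (1 + y) ^ n * Real.exp ((n : ℝ) * δ + a) * Real.exp q := by
        rw [mul_pow, ← Real.exp_nat_mul, Real.exp_add]
        ring
    _ ≤ (1 + y) ^ n * Real.exp b * Real.exp q := by gcongr
    _ = _ := by rw [Real.exp_add]; ring

/-- Monotonicity and monotonicity of increments of `v(t) - t²/2`. -/
lemma v_facts (v v' v'' : ℝ → ℝ)
    (hv : ∀ r ∈ Set.Ici (0 : ℝ), HasDerivWithinAt v (v' r) (Set.Ici 0) r)
    (hv' : ∀ r ∈ Set.Ici (0 : ℝ), HasDerivWithinAt v' (v'' r) (Set.Ici 0) r)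
    (hvmono : MonotoneOn v (Set.Ici 0))
    (hconvex : ∀ r ∈ Set.Ici (0 : ℝ), 1 ≤ v'' r) :
    MonotoneOn (fun t => v t - t ^ 2 / 2) (Ici 0) ∧
    ∀ h, 0 ≤ h → MonotoneOn
      (fun t => (v (t + h) - (t + h) ^ 2 / 2) - (v t - t ^ 2 / 2)) (Ici 0) := by
  have hvc : ContinuousOn v (Ici 0) := fun r hr => (hv r hr).continuousWithinAt
  have hvc' : ContinuousOn v' (Ici 0) := fun r hr => (hv' r hr).continuousWithinAt
  have hvA : ∀ r, 0 < r → HasDerivAt v (v' r) r := fun r hr =>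
    (hv r hr.le).hasDerivAt (Ici_mem_nhds hr)
  have hvA' : ∀ r, 0 < r → HasDerivAt v' (v'' r) r := fun r hr =>
    (hv' r hr.le).hasDerivAt (Ici_mem_nhds hr)
  have hsq : ∀ r : ℝ, HasDerivAt (fun t : ℝ => t ^ 2 / 2) r r := fun r => by
    have := (hasDerivAt_pow 2 r).div_const 2
    refine this.congr_deriv ?_
    simp
  have hm1 : MonotoneOn (fun t => v' t - t) (Ici 0) := by
    refine monotoneOn_of_hasDerivWithinAt_nonneg (f' := fun t => v'' t - 1) (convex_Ici 0)
      (hvc'.sub continuousOn_id) ?_ ?_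
    · intro x hx
      rw [interior_Ici] at hx
      exact ((hvA' x hx).sub (hasDerivAt_id x)).hasDerivWithinAt
    · intro x hx
      rw [interior_Ici] at hx
      rw [mem_Ioi] at hx
      linarith [hconvex x hx.le]
  have hv0 : 0 ≤ v' 0 := by
    have h1 := (hv 0 (by simp)).derivWithin (uniqueDiffOn_Ici 0 0 (by simp))
    rw [← h1]
    exact hvmono.derivWithin_nonneg
  have hm0 : ∀ t, 0 ≤ t → 0 ≤ v' t - t := fun t ht => by
    have := hm1 (a := 0) (by simp) (b := t) ht ht
    simp only at this
    linarith
  constructor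
  · refine monotoneOn_of_hasDerivWithinAt_nonneg (f' := fun t => v' t - t) (convex_Ici 0)
      (hvc.sub (by fun_prop)) ?_ ?_
    · intro x hx
      rw [interior_Ici] at hx
      exact ((hvA x hx).sub (hsq x)).hasDerivWithinAt
    · intro x hx
      rw [interior_Ici] at hx
      exact hm0 x (le_of_lt (mem_Ioi.1 hx))
  · intro h hh
    refine monotoneOn_of_hasDerivWithinAt_nonneg
      (f' := fun t => (v' (t + h) - (t + h)) - (v' t - t)) (convex_Ici 0) ?_ ?_ ?_
    · refine ContinuousOn.sub (ContinuousOn.sub ?_ (by fun_prop)) (hvc.sub (by fun_prop))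
      refine hvc.comp (by fun_prop) ?_
      intro x hx
      have hx : 0 ≤ x := hx
      show 0 ≤ x + h
      linarith
    · intro x hx
      rw [interior_Ici] at hx
      have hx : 0 < x := hx
      have hxh : 0 < x + h := by linarith
      exact ((((hvA _ hxh).comp_add_const x h).sub ((hsq (x + h)).comp_add_const x h)).sub
        ((hvA x hx).sub (hsq x))).hasDerivWithinAt
    · intro x hx
      rw [interior_Ici] at hx
      have hx : 0 < x := hx
      have := hm1 (a := x) hx.le (b := x + h) (by show 0 ≤ x + h; linarith) (by linarith)
      simp only at this
      linarith

lemma radMeasure_apply' (d : ℕ) (v : ℝ → ℝ) (S : Set (EuclideanSpace ℝ (Fin d)))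
    (hS : MeasurableSet S) :
    radMeasure d v S = ∫⁻ x in S, ENNReal.ofReal (Real.exp (v (max ‖x‖ 0))) := by
  rw [radMeasure, withDensity_apply _ hS]
  simp

set_option maxHeartbeats 2000000 in
lemma key_enlarge (d : ℕ) (hd : 2 ≤ d) (v : ℝ → ℝ) (hvc : ContinuousOn v (Ici 0))
    (hp : MonotoneOn (fun t => v t - t ^ 2 / 2) (Ici 0))
    (hq : ∀ h, 0 ≤ h → MonotoneOn
      (fun t => (v (t + h) - (t + h) ^ 2 / 2) - (v t - t ^ 2 / 2)) (Ici 0))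
    (r0 : ℝ) (hr0 : 0 < r0) (hr0d : (d : ℝ) + 1 ≤ r0 ^ 2)
    (A : Set (EuclideanSpace ℝ (Fin d))) (hAopen : IsOpen A)
    (hvol : radMeasure d v A =
      radMeasure d v (Metric.closedBall (0 : EuclideanSpace ℝ (Fin d)) r0))
    (ε : ℝ) (hε : 0 < ε) :
    radMeasure d v (Metric.closedBall (0 : EuclideanSpace ℝ (Fin d)) (r0 + ε)) ≤
      radMeasure d v (Metric.thickening ε A) := by
  set V : ℝ → ℝ := fun r => v (max r 0) with hVdef
  have hV : Continuous V := hvc.comp_continuous (by fun_prop) (fun x => mem_Ici.2 (le_max_right _ _))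
  set T : ℝ → ℝ := fun r : ℝ => r + ε * (1 - (max (1 - r / r0) 0) ^ 2) with hTdef
  set T' : ℝ → ℝ := fun r => 1 + ε * (2 / r0 * max (1 - r / r0) 0) with hT'def
  have hT : ∀ r, HasDerivAt T (T' r) r := hasDerivAt_T r0 ε
  have hmnn : ∀ r : ℝ, 0 ≤ max (1 - r / r0) 0 := fun r => le_max_right _ _
  have hT' : ∀ r, 0 ≤ T' r := fun r => by
    have := hmnn r
    simp only [hT'def]
    positivity
  have hTc : Continuous T' := by simp only [hT'def]; fun_prop
  have hTcont : Continuous T := continuous_iff_continuousAt.2 fun r => (hT r).continuousAt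
  have hm1 : ∀ r : ℝ, 0 ≤ r → max (1 - r / r0) 0 ≤ 1 := fun r hr => by
    have : 0 ≤ r / r0 := by positivity
    exact max_le (by linarith) (by norm_num)
  have hφ : ∀ r : ℝ, 0 ≤ r → 0 ≤ 1 - (max (1 - r / r0) 0) ^ 2 := fun r hr => by
    nlinarith [hm1 r hr, hmnn r]
  have hpos : ∀ r, 0 < r → 0 < T r := fun r hr => by
    have := mul_nonneg hε.le (hφ r hr.le)
    simp only [hTdef]
    linarith
  have hTle : ∀ r, T r ≤ r + ε := fun r => by
    simp only [hTdef]
    nlinarith [mul_nonneg hε.le (sq_nonneg (max (1 - r / r0) 0))]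
  have hT0 : T 0 = 0 := by simp [hTdef]
  have hTr0 : T r0 = r0 + ε := by simp [hTdef, hr0.ne']
  have hη : 0 < ε / r0 := by positivity
  rw [radMeasure_apply' d v _ measurableSet_closedBall,
    radMeasure_apply' d v _ isOpen_thickening.measurableSet]
  rw [radMeasure_apply' d v _ measurableSet_closedBall,
    radMeasure_apply' d v _ hAopen.measurableSet] at hvol
  have step1 := transport_ge hd T T' V hT hT' hpos hV hTc
    (closedBall 0 r0) (closedBall 0 (r0 + ε)) measurableSet_closedBall measurableSet_closedBall
    (by
      intro θ t hθ ht htm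
      have ht2 : t ≤ r0 + ε := by simpa [norm_smul, hθ, abs_of_pos ht] using htm
      have hiv := intermediate_value_Icc hr0.le hTcont.continuousOn
      rw [hT0, hTr0] at hiv
      obtain ⟨r, ⟨hr1, hr2⟩, hr3⟩ := hiv ⟨ht.le, ht2⟩
      have hrpos : 0 < r := by
        rcases hr1.eq_or_lt with h | h
        · rw [← h, hT0] at hr3
          linarith
        · exact h
      refine ⟨r, hrpos, ?_, hr3⟩
      simpa [norm_smul, hθ, abs_of_pos hrpos] using hr2)
  have step3 := transport_le hd T T' V hT hT' hpos hV hTc A (thickening ε A)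
    hAopen.measurableSet isOpen_thickening.measurableSet
    (by
      intro θ r hθ hr hrA
      have hc : ContinuousAt (fun s : ℝ => (r + s) • θ) 0 := by fun_prop
      have hmem : ∀ᶠ s : ℝ in nhds 0, (r + s) • θ ∈ A :=
        hc.eventually (by simpa using hAopen.mem_nhds hrA)
      have hmem2 : ∀ᶠ s : ℝ in nhdsWithin 0 (Ioi 0), (r + s) • θ ∈ A ∧ s < ε ∧ 0 < s := by
        filter_upwards [hmem.filter_mono nhdsWithin_le_nhds,
          nhdsWithin_le_nhds (Iio_mem_nhds hε), self_mem_nhdsWithin] with s h1 h2 h3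
        exact ⟨h1, h2, h3⟩
      obtain ⟨s, hsA, hsε, hs0⟩ := hmem2.exists
      refine mem_thickening_iff.2 ⟨_, hsA, ?_⟩
      rw [dist_eq_norm, ← sub_smul, norm_smul, hθ, mul_one, Real.norm_eq_abs, abs_lt]
      have h1 := hTle r
      have h2 : r ≤ T r := by
        have := mul_nonneg hε.le (hφ r hr.le)
        simp only [hTdef]
        linarith
      constructor <;> linarith)
  set c : ℝ := (1 + ε / r0) ^ (d - 1) * Real.exp (v (r0 + ε) - v r0) with hc
  have hc0 : 0 ≤ c := by positivity
  have hdc : ((d - 1 : ℕ) : ℝ) = d - 1 := by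
    rw [Nat.cast_sub (by omega)]; simp
  -- comparison inside
  have hin : ∀ r, 0 < r → r ≤ r0 →
      T' r * (T r / r) ^ (d - 1) * Real.exp (V (T r)) ≤ c * Real.exp (V r) := by
    intro r hr hrr
    have hs : r / r0 ≤ 1 := (div_le_one hr0).2 hrr
    have hmeq : max (1 - r / r0) 0 = 1 - r / r0 := max_eq_left (by linarith)
    set m := 1 - r / r0 with hm
    have hmn : 0 ≤ m := by linarith
    have hrm : r = r0 * (1 - m) := by rw [hm]; field_simp; ring
    have hm1' : m < 1 := by
      have : 0 < r / r0 := by positivity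
      linarith
    have hTr : T r = r + ε * (1 - m ^ 2) := by simp only [hTdef]; rw [hmeq]
    have hT'r : T' r = 1 + 2 * (ε / r0 * m) := by
      simp only [hT'def]; rw [hmeq]; ring
    have hquo : T r / r = 1 + ε / r0 * (1 + m) := by
      rw [hTr, hrm]
      have : 1 - m ≠ 0 := by linarith
      field_simp
      ring
    have hV1 : V (T r) = (v (T r) - v r) + v r := by
      simp only [hVdef]; rw [max_eq_left (hpos r hr).le]; ring
    have hV2 : V r = v r := by simp only [hVdef]; rw [max_eq_left hr.le]
    rw [hV1, hV2, hT'r, hquo, hc]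
    refine ineq_in (d - 1) (ε / r0) m _ _ _ hη.le hmn ?_
    rw [hdc]
    have hφ0 : 0 ≤ 1 - m ^ 2 := by nlinarith
    have hh : 0 ≤ ε * (1 - m ^ 2) := by positivity
    have e1 := hq (ε * (1 - m ^ 2)) hh (a := r) hr.le (b := r0) hr0.le hrr
    have hle : r0 + ε * (1 - m ^ 2) ≤ r0 + ε := by nlinarith [mul_nonneg hε.le (sq_nonneg m)]
    have e2 := hp (a := r0 + ε * (1 - m ^ 2)) (mem_Ici.2 (by linarith)) (b := r0 + ε)
      (by show 0 ≤ r0 + ε; linarith) hle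
    simp only at e1 e2
    rw [← hTr] at e1
    have e3 : (d - 1 + 2 : ℝ) * (ε / r0 * m) ≤ ε * r0 * m := by
      have : (d - 1 + 2 : ℝ) * (ε / r0 * m) = ((d : ℝ) + 1) * (ε / r0 * m) := by ring
      rw [this]
      calc ((d : ℝ) + 1) * (ε / r0 * m) ≤ r0 ^ 2 * (ε / r0 * m) := by gcongr
        _ = ε * r0 * m := by field_simp
    have e4 : T r ^ 2 / 2 - r ^ 2 / 2 + ε * r0 * m ≤ (r0 + ε) ^ 2 / 2 - r0 ^ 2 / 2 := by
      have f1 : T r ^ 2 / 2 - r ^ 2 / 2 = ε * ((1 - m ^ 2) * r) + ε ^ 2 * (1 - m ^ 2) ^ 2 / 2 := by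
        rw [hTr]; ring
      have f2 : (1 - m ^ 2) * r ≤ r0 * (1 - m) := by
        rw [← hrm]; nlinarith [mul_nonneg (sq_nonneg m) hr.le]
      have f3 : (1 - m ^ 2) ^ 2 ≤ 1 := pow_le_one₀ hφ0 (by linarith [sq_nonneg m])
      have f4 := mul_le_mul_of_nonneg_left f2 hε.le
      have f5 := mul_le_mul_of_nonneg_left f3 (sq_nonneg ε)
      have f6 : ε * (r0 * (1 - m)) = ε * r0 - ε * r0 * m := by ring
      have f7 : (r0 + ε) ^ 2 / 2 - r0 ^ 2 / 2 = ε * r0 + ε ^ 2 / 2 := by ring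
      linarith
    linarith
  have hout : ∀ r, r0 < r →
      c * Real.exp (V r) ≤ T' r * (T r / r) ^ (d - 1) * Real.exp (V (T r)) := by
    intro r hrr
    have hr : 0 < r := hr0.trans hrr
    have hs : 1 ≤ r / r0 := (one_le_div hr0).2 hrr.le
    have hmeq : max (1 - r / r0) 0 = 0 := max_eq_right (by linarith)
    have hTr : T r = r + ε := by simp only [hTdef]; rw [hmeq]; ring
    have hT'r : T' r = 1 := by simp only [hT'def]; rw [hmeq]; ring
    have hquo : T r / r = 1 + ε / r := by
      rw [hTr]; field_simp
    have hV1 : V (T r) = (v (r + ε) - v r) + v r := by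
      simp only [hVdef]; rw [max_eq_left (hpos r hr).le, hTr]; ring
    have hV2 : V r = v r := by simp only [hVdef]; rw [max_eq_left hr.le]
    rw [hV1, hV2, hT'r, hquo, hc, one_mul]
    have hδ : ε / r0 = ε / r + ε * (r - r0) / (r * r0) := by field_simp; ring
    have hrr' : 0 ≤ r - r0 := by linarith
    refine ineq_out (d - 1) (ε / r0) (ε / r) (ε * (r - r0) / (r * r0)) _ _ _ (by positivity)
      (by positivity) hδ ?_
    rw [hdc]
    have e1 := hq ε hε.le (a := r0) hr0.le (b := r) hr.le hrr.le
    simp only at e1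
    have e3 : ((d : ℝ) - 1) * (ε * (r - r0) / (r * r0)) ≤ ε * (r - r0) := by
      calc ((d : ℝ) - 1) * (ε * (r - r0) / (r * r0))
          ≤ (r * r0) * (ε * (r - r0) / (r * r0)) := by
            gcongr
            nlinarith
        _ = ε * (r - r0) := by field_simp
    nlinarith
  have hfin : ∫⁻ x in closedBall (0 : EuclideanSpace ℝ (Fin d)) r0,
      ENNReal.ofReal (Real.exp (V ‖x‖)) ≠ ∞ := by
    have hcont : Continuous fun x : EuclideanSpace ℝ (Fin d) => Real.exp (V ‖x‖) := by fun_prop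
    have hi := hcont.continuousOn.integrableOn_compact (μ := volume)
      (isCompact_closedBall (0 : EuclideanSpace ℝ (Fin d)) r0)
    exact hi.lintegral_lt_top.ne
  have h0A : ∀ x : EuclideanSpace ℝ (Fin d), x ∈ closedBall 0 r0 → x ≠ 0 →
      ENNReal.ofReal (T' ‖x‖ * (T ‖x‖ / ‖x‖) ^ (d - 1) * Real.exp (V (T ‖x‖))) ≤
        ENNReal.ofReal c * ENNReal.ofReal (Real.exp (V ‖x‖)) := by
    intro x hx hx0
    rw [← ENNReal.ofReal_mul hc0]
    exact ENNReal.ofReal_le_ofReal (hin _ (norm_pos_iff.2 hx0) (by simpa using hx))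
  have step2 := swap_le (volume : Measure (EuclideanSpace ℝ (Fin d)))
    (fun x => ENNReal.ofReal (T' ‖x‖ * (T ‖x‖ / ‖x‖) ^ (d - 1) * Real.exp (V (T ‖x‖))))
    (fun x => ENNReal.ofReal (Real.exp (V ‖x‖))) (ENNReal.ofReal c) (by fun_prop)
    A (closedBall 0 r0) hAopen.measurableSet measurableSet_closedBall hfin hvol
    (by
      intro x hx _
      by_cases hx0 : x = 0
      · subst hx0
        have : d - 1 ≠ 0 := by omega
        simp [this]
      · exact h0A x hx hx0)
    (by
      intro x hx
      rw [← ENNReal.ofReal_mul hc0]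
      exact ENNReal.ofReal_le_ofReal (hout _ (by simpa using hx)))
  exact step1.trans (step2.trans step3)

theorem stmt_11 (d : ℕ) (hd : 2 ≤ d) (v v' v'' : ℝ → ℝ)
    (hv : ∀ r ∈ Set.Ici (0 : ℝ), HasDerivWithinAt v (v' r) (Set.Ici 0) r)
    (hv' : ∀ r ∈ Set.Ici (0 : ℝ), HasDerivWithinAt v' (v'' r) (Set.Ici 0) r)
    (hv''cont : ContinuousOn v'' (Set.Ici 0))
    (hvmono : MonotoneOn v (Set.Ici 0))
    (hconvex : ∀ r ∈ Set.Ici (0 : ℝ), 1 ≤ v'' r)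
    (r0 : ℝ) (hr0 : Real.sqrt (d + 2) ≤ r0)
    (A : Set (EuclideanSpace ℝ (Fin d)))
    (hAbd : Bornology.IsBounded A) (hAopen : IsOpen A) (hAsm : HasSmoothBoundary A)
    (hvol : radMeasure d v A =
      radMeasure d v (Metric.closedBall (0 : EuclideanSpace ℝ (Fin d)) r0)) :
    surfaceMeasure (radMeasure d v) (Metric.closedBall (0 : EuclideanSpace ℝ (Fin d)) r0) ≤
      surfaceMeasure (radMeasure d v) A := by
  have hd0 : (0 : ℝ) < (d : ℝ) + 2 := by positivity
  have hr0pos : 0 < r0 := (Real.sqrt_pos.2 hd0).trans_le hr0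
  have hr0d : (d : ℝ) + 1 ≤ r0 ^ 2 := by
    have h1 := Real.sq_sqrt hd0.le
    have h2 : Real.sqrt (d + 2) ^ 2 ≤ r0 ^ 2 := by gcongr
    linarith
  obtain ⟨hp, hq⟩ := v_facts v v' v'' hv hv' hvmono hconvex
  have hvc : ContinuousOn v (Ici 0) := fun r hr => (hv r hr).continuousWithinAt
  refine liminf_le_liminf ?_
  filter_upwards [self_mem_nhdsWithin] with ε hε
  have hε : 0 < ε := hε
  have key := key_enlarge d hd v hvc hp hq r0 hr0pos hr0d A hAopen hvol ε hε
  have hsub : Metric.thickening ε (Metric.closedBall (0 : EuclideanSpace ℝ (Fin d)) r0) ⊆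
      Metric.closedBall 0 (r0 + ε) := by
    intro x hx
    obtain ⟨y, hy, hxy⟩ := Metric.mem_thickening_iff.1 hx
    rw [Metric.mem_closedBall] at hy ⊢
    linarith [dist_triangle x y 0]
  rw [hvol]
  gcongr ?_ / _
  exact tsub_le_tsub_right ((measure_mono hsub).trans key) _
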